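/- arXiv:1706.08110 — 5 statements merged into one kernel-verified Lean document; each statement's English description precedes it below -/
import Mathlib

section
/- Let m, n be positive natural numbers with n ≥ 2, and equip H = Matrix (Fin m) (Fin n) ℝ with the matrix inner product ⟨X,Y⟩ = XᵀY. Then H has no orthogonal basis: there is no finite family A₁,…,A_p of matrices in H that is linearly independent over ℝ, spans H, and satisfies AᵢᵀAⱼ = 0 for all i ≠ j. -/
open Matrix

/-- For `n ≥ 2`, the matrix Hilbert space `ℝ^{m×n}` with matrix inner product
`⟨X,Y⟩ = XᵀY` has no orthogonal basis: there is no finite, linearly independent,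
spanning family `A₁,…,A_p` with `AᵢᵀAⱼ = 0` for all `i ≠ j`. -/
theorem no_orthogonal_basis_transpose_mul {m n : ℕ} (hm : 0 < m) (hn : 2 ≤ n) :
    ¬ ∃ (p : ℕ) (A : Fin p → Matrix (Fin m) (Fin n) ℝ),
        LinearIndependent ℝ A ∧
        (∀ X : Matrix (Fin m) (Fin n) ℝ, ∃ c : Fin p → ℝ, X = ∑ i, c i • A i) ∧
        (∀ i j, i ≠ j → (A i)ᵀ * A j = 0) := by
  rintro ⟨p, A, -, hspan, horth⟩
  -- every `(A j)ᵀ * X` is symmetric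
  have hsymm : ∀ j (X : Matrix (Fin m) (Fin n) ℝ), ((A j)ᵀ * X)ᵀ = (A j)ᵀ * X := by
    intro j X
    obtain ⟨c, rfl⟩ := hspan X
    have h : (A j)ᵀ * ∑ i, c i • A i = c j • ((A j)ᵀ * A j) := by
      rw [Matrix.mul_sum, Finset.sum_eq_single j]
      · rw [Matrix.mul_smul]
      · intro i _ hij
        rw [Matrix.mul_smul, horth j i hij.symm, smul_zero]
      · simp
    rw [h, Matrix.transpose_smul, Matrix.transpose_mul, Matrix.transpose_transpose]
  have : Nontrivial (Fin n) := Fin.nontrivial_iff_two_le.mpr hn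
  have hzero : ∀ j, A j = 0 := by
    intro j
    ext a k
    obtain ⟨b, hb⟩ := exists_ne k
    have h := congrFun (congrFun (hsymm j (Matrix.single a b 1)) b) k
    simpa [Matrix.transpose_apply, hb, hb.symm] using h
  obtain ⟨c, hc⟩ := hspan (fun _ _ => 1)
  have h := congrFun (congrFun hc ⟨0, hm⟩) ⟨0, by omega⟩
  simp [hzero] at h
end

section
/- Let H be a real vector space, n a positive natural number, ⟨·,·⟩ a matrix inner product on H, and A₁,…,A_p an orthogonal basis of H. Let f : H → Matrix (Fin n) (Fin n) ℝ be an ℝ-linear map such that for every i there exists a real scalar αᵢ with f(Aᵢ) = αᵢ • ⟨Aᵢ,Aᵢ⟩. Then there exists X ∈ H such that f(Y) = ⟨Y,X⟩ for all Y ∈ H (surjectivity part of the Weak Riesz Representation Theorem, Theorem 2). -/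
open Matrix

/-- A matrix inner product on a real vector space `H`, with values in
`n × n` real matrices. -/
structure MatrixInnerProduct (H : Type*) [AddCommGroup H] [Module ℝ H] (n : ℕ) where
  ip : H → H → Matrix (Fin n) (Fin n) ℝ
  symm : ∀ X Y : H, ip Y X = (ip X Y)ᵀ
  add_smul_left : ∀ (a b : ℝ) (X₁ X₂ Y : H),
    ip (a • X₁ + b • X₂) Y = a • ip X₁ Y + b • ip X₂ Y
  self_eq_zero_iff : ∀ X : H, ip X X = 0 ↔ X = 0
  posSemidef_self : ∀ X : H, (ip X X).PosSemidef

/-- A finite family `A₁,…,A_p` is an orthogonal basis of `H` (w.r.t. a matrix inner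
product) if it is linearly independent, spans `H`, and `⟨Aᵢ,Aⱼ⟩ = 0` for `i ≠ j`. -/
def IsOrthogonalBasis {H : Type*} [AddCommGroup H] [Module ℝ H] {n : ℕ}
    (P : MatrixInnerProduct H n) {p : ℕ} (A : Fin p → H) : Prop :=
  LinearIndependent ℝ A ∧
  (∀ X : H, ∃ c : Fin p → ℝ, X = ∑ i, c i • A i) ∧
  (∀ i j, i ≠ j → P.ip (A i) (A j) = 0)

/-- Surjectivity part of the Weak Riesz Representation Theorem (Theorem 2):
every `ℝ`-linear map `f : H → ℝ^{n×n}` with `f(Aᵢ) = αᵢ • ⟨Aᵢ,Aᵢ⟩` for each basis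
element is of the form `f(Y) = ⟨Y,X⟩` for some `X ∈ H`. -/
theorem matrix_inner_riesz_surjective {H : Type*} [AddCommGroup H] [Module ℝ H]
    {n : ℕ} (hn : 0 < n) (P : MatrixInnerProduct H n)
    {p : ℕ} (A : Fin p → H) (hA : IsOrthogonalBasis P A)
    (f : H →ₗ[ℝ] Matrix (Fin n) (Fin n) ℝ)
    (hf : ∀ i, ∃ α : ℝ, f (A i) = α • P.ip (A i) (A i)) :
    ∃ X : H, ∀ Y : H, f Y = P.ip Y X := by
  obtain ⟨_, hspan, horth⟩ := hA
  choose α hα using hf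
  -- linearity in the left argument
  let L : H → (H →ₗ[ℝ] Matrix (Fin n) (Fin n) ℝ) := fun Z =>
    { toFun := fun Y => P.ip Y Z
      map_add' := fun X Y => by
        simpa using P.add_smul_left 1 1 X Y Z
      map_smul' := fun a X => by
        simpa using P.add_smul_left a 0 X 0 Z }
  have hL : ∀ Z Y, P.ip Y Z = L Z Y := fun _ _ => rfl
  refine ⟨∑ i, α i • A i, fun Y => ?_⟩
  have key : ∀ j, f (A j) = L (∑ i, α i • A i) (A j) := by
    intro j
    rw [hα, ← hL, P.symm (∑ i, α i • A i) (A j), hL (A j) (∑ i, α i • A i), map_sum, Finset.sum_eq_single j]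
    · rw [map_smul, ← hL, Matrix.transpose_smul, ← P.symm]
    · intro i _ hij
      rw [map_smul, ← hL, horth i j hij, smul_zero]
    · intro h
      exact absurd (Finset.mem_univ j) h
  obtain ⟨c, rfl⟩ := hspan Y
  rw [hL, map_sum, map_sum]
  refine Finset.sum_congr rfl fun j _ => ?_
  rw [map_smul, map_smul, key]
end

section
/- Let H be a real vector space, n a positive natural number, ⟨·,·⟩ a matrix inner product on H, and A₁,…,A_p an orthogonal basis of H. Then the map X ↦ (Z ↦ ⟨Z,X⟩) is a bijection from H onto the set of ℝ-linear maps f : H → Matrix (Fin n) (Fin n) ℝ such that for every i there exists a real scalar αᵢ with f(Aᵢ) = αᵢ • ⟨Aᵢ,Aᵢ⟩ (Weak Riesz Representation Theorem, Theorem 2). -/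
open Matrix

/-- Weak Riesz Representation Theorem (Theorem 2): the map `X ↦ (Z ↦ ⟨Z,X⟩)` is a
bijection from `H` onto the set of `ℝ`-linear maps `f : H → ℝ^{n×n}` such that each
`f(Aᵢ)` is a real scalar multiple of `⟨Aᵢ,Aᵢ⟩`. -/
theorem weak_riesz_representation {H : Type*} [AddCommGroup H] [Module ℝ H]
    {n : ℕ} (hn : 0 < n) (P : MatrixInnerProduct H n)
    {p : ℕ} (A : Fin p → H) (hA : IsOrthogonalBasis P A) :
    Function.Injective (fun X : H => fun Z : H => P.ip Z X) ∧
    Set.range (fun X : H => fun Z : H => P.ip Z X) =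
      {f : H → Matrix (Fin n) (Fin n) ℝ |
        IsLinearMap ℝ f ∧ ∀ i, ∃ α : ℝ, f (A i) = α • P.ip (A i) (A i)} := by
  obtain ⟨_, hspan, horth⟩ := hA
  have hlin : ∀ Y, IsLinearMap ℝ (fun Z => P.ip Z Y) := fun Y =>
    ⟨fun x y => by simpa using P.add_smul_left 1 1 x y Y,
     fun c x => by simpa using P.add_smul_left c 0 x 0 Y⟩
  have hlinr : ∀ Y, IsLinearMap ℝ (fun Z => P.ip Y Z) := fun Y =>
    ⟨fun x y => by
      change P.ip Y (x + y) = P.ip Y x + P.ip Y y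
      rw [P.symm (x + y) Y, P.symm x Y, P.symm y Y, ← Matrix.transpose_add]
      exact congrArg _ ((hlin Y).map_add x y),
     fun c x => by
      change P.ip Y (c • x) = c • P.ip Y x
      rw [P.symm (c • x) Y, P.symm x Y, ← Matrix.transpose_smul]
      exact congrArg _ ((hlin Y).map_smul c x)⟩
  have key : ∀ (c : Fin p → ℝ) i,
      P.ip (A i) (∑ j, c j • A j) = c i • P.ip (A i) (A i) := by
    intro c i
    have h := map_sum (hlinr (A i)).mk' (fun j => c j • A j) Finset.univ
    simp only [map_smul, IsLinearMap.mk'_apply] at h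
    rw [h, Finset.sum_eq_single i]
    · intro j _ hj
      rw [horth i j hj.symm, smul_zero]
    · simp
  refine ⟨?_, ?_⟩
  · intro X Y h
    have h1 : P.ip (X - Y) X = P.ip (X - Y) Y := congrFun h (X - Y)
    have h2 : P.ip (X - Y) (X - Y) = 0 := by
      have h3 := (hlinr (X - Y)).map_sub X Y
      rw [h3, h1, sub_self]
    exact sub_eq_zero.mp ((P.self_eq_zero_iff _).mp h2)
  · ext f
    constructor
    · rintro ⟨X, rfl⟩
      refine ⟨hlin X, fun i => ?_⟩
      obtain ⟨c, rfl⟩ := hspan X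
      exact ⟨c i, key c i⟩
    · rintro ⟨hf, hα⟩
      choose α hα using hα
      refine ⟨∑ j, α j • A j, ?_⟩
      funext Z
      obtain ⟨c, rfl⟩ := hspan Z
      have h1 := map_sum (hlin (∑ j, α j • A j)).mk' (fun j => c j • A j) Finset.univ
      have h2 := map_sum hf.mk' (fun j => c j • A j) Finset.univ
      simp only [map_smul, IsLinearMap.mk'_apply] at h1 h2
      change P.ip (∑ j, c j • A j) (∑ j, α j • A j) = _
      rw [h1, h2]
      exact Finset.sum_congr rfl fun i _ => by rw [key, hα]
end

section
/- Let m, n be positive natural numbers, 𝒳 = Matrix (Fin m) (Fin n) ℝ, α ≥ 0 a real number, and β ∈ ℕ. The polynomial matrix kernel K(X,Y) = (XᵀY + α·I_n)^{∘β}, where ^{∘β} denotes the β-fold entrywise (Hadamard) power, is a positive semidefinite matrix kernel on 𝒳. -/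
open Matrix

/-- A positive semidefinite matrix kernel on a set `𝒳`: it is "transpose-symmetric"
and all its Gram-type combinations `Σᵢⱼ αᵢαⱼ K(Xᵢ,Xⱼ)` are positive semidefinite. -/
def IsPSDMatrixKernel {𝒳 : Type*} {n : ℕ} (K : 𝒳 → 𝒳 → Matrix (Fin n) (Fin n) ℝ) : Prop :=
  (∀ X Y : 𝒳, K X Y = (K Y X)ᵀ) ∧
  (∀ (m : ℕ) (X : Fin m → 𝒳) (α : Fin m → ℝ),
    (∑ i, ∑ j, (α i * α j) • K (X i) (X j)).PosSemidef)

/-- The `β`-fold entrywise (Hadamard) power of a matrix. -/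
def hadamardPow {n : ℕ} (A : Matrix (Fin n) (Fin n) ℝ) (β : ℕ) :
    Matrix (Fin n) (Fin n) ℝ :=
  Matrix.of fun i j => (A i j) ^ β

/-- Entrywise powers of a real positive semidefinite matrix are positive semidefinite. -/
theorem posSemidef_entrywise_pow {ι : Type*} [Fintype ι] [DecidableEq ι] {A : Matrix ι ι ℝ}
    (hA : A.PosSemidef) (β : ℕ) : (Matrix.of fun i j => (A i j) ^ β).PosSemidef := by
  induction β with
  | zero =>
    have h := Matrix.posSemidef_conjTranspose_mul_self (Matrix.of fun (_ : Unit) (_ : ι) => (1 : ℝ))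
    convert h using 1
    ext i j
    simp [Matrix.mul_apply]
  | succ k ih =>
    have h := Matrix.PosSemidef.hadamard ih hA
    have e : (Matrix.of fun i j => (A i j) ^ (k + 1)) = (Matrix.of fun i j => (A i j) ^ k) ⊙ A := by
      ext i j
      simp [pow_succ]
    rw [e]
    exact h

/-- The polynomial matrix kernel `K(X,Y) = (XᵀY + α·Iₙ)^{∘β}` (entrywise `β`-th power)
on `𝒳 = ℝ^{m×n}` is a positive semidefinite matrix kernel, for `α ≥ 0` and `β ∈ ℕ`. -/
theorem isPSDMatrixKernel_polynomial {m n : ℕ} (hm : 0 < m) (hn : 0 < n)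
    (α : ℝ) (hα : 0 ≤ α) (β : ℕ) :
    IsPSDMatrixKernel
      (fun X Y : Matrix (Fin m) (Fin n) ℝ =>
        hadamardPow (Xᵀ * Y + α • (1 : Matrix (Fin n) (Fin n) ℝ)) β) := by
  constructor
  · intro X Y
    ext a b
    simp only [hadamardPow, Matrix.of_apply, Matrix.transpose_apply, Matrix.add_apply,
      Matrix.mul_apply, Matrix.smul_apply, Matrix.one_apply, eq_comm (a := a) (b := b), mul_comm]
  · intro k X c
    let Z : Matrix (Fin m) (Fin k × Fin n) ℝ := Matrix.of fun r p => X p.1 r p.2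
    let E : Matrix (Fin n) (Fin k × Fin n) ℝ := Matrix.of fun r p => if r = p.2 then 1 else 0
    let C : Matrix (Fin k × Fin n) (Fin n) ℝ := Matrix.of fun p b => if p.2 = b then c p.1 else 0
    have hM : (Zᴴ * Z + α • (Eᴴ * E)).PosSemidef :=
      (Matrix.posSemidef_conjTranspose_mul_self Z).add
        ((Matrix.posSemidef_conjTranspose_mul_self E).smul hα)
    have h := (posSemidef_entrywise_pow hM β).conjTranspose_mul_mul_same C
    convert h using 1
    ext a b
    simp only [Matrix.sum_apply, Matrix.smul_apply, hadamardPow, Matrix.of_apply,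
      Matrix.mul_apply, Matrix.conjTranspose_apply, Matrix.add_apply, Matrix.transpose_apply,
      Matrix.one_apply, Z, E, C, star_trivial, smul_eq_mul, Fintype.sum_prod_type,
      ite_mul, mul_ite, mul_zero, zero_mul, mul_one, Finset.sum_ite_eq', Finset.sum_ite_eq,
      Finset.mem_univ, if_true, Finset.sum_mul]
    rw [Finset.sum_comm]
    refine Finset.sum_congr rfl fun i _ => Finset.sum_congr rfl fun j _ => ?_
    simp only [eq_comm (a := a) (b := b)]
    ring
end

section
/- Let m, n be positive natural numbers, 𝒳 = Matrix (Fin m) (Fin n) ℝ, and γ > 0 a real number. The Gaussian matrix kernel K(X,Y) whose (i,j) entry is exp(−γ‖X(:,i) − Y(:,j)‖²), where X(:,i) denotes the i-th column of X and ‖·‖ is the Euclidean norm on ℝᵐ, is a positive semidefinite matrix kernel on 𝒳. -/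
open Matrix

/-- Entrywise powers of a Gram matrix are positive semidefinite. -/
lemma gram_pow_posSemidef {ι : Type} [Fintype ι] {m : ℕ} (v : ι → Fin m → ℝ) (k : ℕ) :
    (Matrix.of fun p q : ι => (∑ r, v p r * v q r) ^ k).PosSemidef := by
  induction k with
  | zero =>
    convert posSemidef_vecMulVec_self_star (fun _ : ι => (1 : ℝ)) using 1
    ext p q
    simp [vecMulVec]
  | succ k ih =>
    have h1 : (Matrix.of fun p q : ι => ∑ r, v p r * v q r).PosSemidef := by
      convert posSemidef_self_mul_conjTranspose (Matrix.of v) using 1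
      ext p q
      simp [Matrix.mul_apply]
    have h2 : (Matrix.of fun p q : ι => (∑ r, v p r * v q r) ^ (k + 1))
        = (Matrix.of fun p q : ι => (∑ r, v p r * v q r) ^ k) ⊙
          (Matrix.of fun p q : ι => ∑ r, v p r * v q r) := by
      ext p q
      simp [pow_succ]
    rw [h2]
    exact ih.hadamard h1

/-- The scalar Gaussian kernel is positive semidefinite. -/
lemma gaussian_sum_nonneg {ι : Type} [Fintype ι] {m : ℕ} (v : ι → Fin m → ℝ)
    (γ : ℝ) (hγ : 0 < γ) (c : ι → ℝ) :
    0 ≤ ∑ p, ∑ q, c p * c q * Real.exp (-γ * ∑ r, (v p r - v q r) ^ 2) := by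
  set d : ι → ℝ := fun p => c p * Real.exp (-γ * ∑ r, v p r ^ 2) with hd
  have key : ∀ p q, c p * c q * Real.exp (-γ * ∑ r, (v p r - v q r) ^ 2)
      = d p * d q * Real.exp (2 * γ * ∑ r, v p r * v q r) := by
    intro p q
    have : -γ * ∑ r, (v p r - v q r) ^ 2 = -γ * ∑ r, v p r ^ 2 + -γ * ∑ r, v q r ^ 2
        + 2 * γ * ∑ r, v p r * v q r := by
      simp only [Finset.mul_sum, ← Finset.sum_add_distrib]
      exact Finset.sum_congr rfl fun r _ => by ring
    rw [this, Real.exp_add, Real.exp_add, hd]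
    ring
  simp only [key]
  have hs : HasSum (fun k : ℕ => ∑ p, ∑ q,
      d p * d q * ((2 * γ * ∑ r, v p r * v q r) ^ k / (k.factorial : ℝ)))
      (∑ p, ∑ q, d p * d q * Real.exp (2 * γ * ∑ r, v p r * v q r)) := by
    refine hasSum_sum fun p _ => hasSum_sum fun q _ => HasSum.mul_left _ ?_
    rw [Real.exp_eq_exp_ℝ]
    exact NormedSpace.expSeries_div_hasSum_exp _
  refine hs.nonneg fun k => ?_
  have h := (gram_pow_posSemidef v k).dotProduct_mulVec_nonneg d
  have h2 : 0 ≤ (2 * γ) ^ k / (k.factorial : ℝ) := by positivity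
  refine (mul_nonneg h2 h).trans_eq ?_
  simp only [dotProduct, mulVec, Finset.mul_sum, Matrix.of_apply, Pi.star_apply, star_trivial]
  refine Finset.sum_congr rfl fun p _ => Finset.sum_congr rfl fun q _ => ?_
  simp only [← Finset.mul_sum, mul_pow]
  ring


/-- The Gaussian matrix kernel `K(X,Y)ᵢⱼ = exp(−γ‖X(:,i) − Y(:,j)‖²)`, where
`X(:,i)` is the `i`-th column of `X` and `‖·‖²` is the squared Euclidean norm
`Σᵣ (Xᵣᵢ − Yᵣⱼ)²`, is a positive semidefinite matrix kernel on `𝒳 = ℝ^{m×n}`,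
for `γ > 0`. -/
theorem isPSDMatrixKernel_gaussian {m n : ℕ} (hm : 0 < m) (hn : 0 < n)
    (γ : ℝ) (hγ : 0 < γ) :
    IsPSDMatrixKernel
      (fun X Y : Matrix (Fin m) (Fin n) ℝ =>
        Matrix.of fun i j : Fin n => Real.exp (-γ * ∑ r, (X r i - Y r j) ^ 2)) := by
  have hsymm : ∀ X Y : Matrix (Fin m) (Fin n) ℝ, ∀ i j : Fin n,
      Real.exp (-γ * ∑ r, (X r i - Y r j) ^ 2) = Real.exp (-γ * ∑ r, (Y r j - X r i) ^ 2) := by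
    intro X Y i j
    congr 2
    exact Finset.sum_congr rfl fun r _ => by ring
  refine ⟨fun X Y => ?_, fun M X α => ?_⟩
  · ext i j
    exact hsymm X Y i j
  · refine PosSemidef.of_dotProduct_mulVec_nonneg ?_ fun x => ?_
    · ext a b
      simp only [conjTranspose_apply, Matrix.sum_apply, Matrix.smul_apply, Matrix.of_apply,
        star_trivial, smul_eq_mul]
      rw [Finset.sum_comm]
      refine Finset.sum_congr rfl fun i _ => Finset.sum_congr rfl fun j _ => ?_
      rw [hsymm, mul_comm (α j)]
    · have h := gaussian_sum_nonneg (ι := Fin n × Fin M) (fun p r => X p.2 r p.1) γ hγ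
        (fun p => x p.1 * α p.2)
      refine h.trans_eq ?_
      simp only [dotProduct, mulVec, Fintype.sum_prod_type, Matrix.sum_apply, Matrix.smul_apply,
        Matrix.of_apply, Pi.star_apply, star_trivial, smul_eq_mul]
      refine Finset.sum_congr rfl fun a _ => ?_
      rw [Finset.sum_comm, Finset.mul_sum]
      refine Finset.sum_congr rfl fun b _ => ?_
      rw [Finset.sum_mul, Finset.mul_sum]
      refine Finset.sum_congr rfl fun i _ => ?_
      rw [Finset.sum_mul, Finset.mul_sum]
      refine Finset.sum_congr rfl fun j _ => ?_
      ring
end
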